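/- Let j ∈ ℕ, let α satisfy max(0, d-2j-2) < α < d-2j, and set γ = α - d + 2j + 1 ∈ (-1,1). There exists a constant c > 0 depending only on α, d and j such that for every μ ∈ C_c^∞(ℝ^d;ℝ): if j is odd, then ∬_{ℝ^d×ℝ^d} μ(x) μ(y) |x-y|^{-α} dx dy = c ∬_{ℝ^d×(0,∞)} ξ^γ |Δ_γ^{(j+1)/2} 𝒦_{μ,α}(x,ξ)|² dx dξ; and if j is even, then ∬_{ℝ^d×ℝ^d} μ(x) μ(y) |x-y|^{-α} dx dy = c ∬_{ℝ^d×(0,∞)} ξ^γ |∇_{(x,ξ)} Δ_γ^{j/2} 𝒦_{μ,α}(x,ξ)|² dx dξ, where ∇_{(x,ξ)} is the full gradient in all d+1 variables. -/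

import Mathlib

open MeasureTheory

noncomputable section

/-- The operator `Δ_γ f = Δ_{(x,ξ)} f + (γ/ξ) ∂_ξ f` on functions on `ℝ^d × ℝ`
(relevant on the upper half-space `ξ > 0`). -/
noncomputable def dgamma (d : ℕ) (γ : ℝ)
    (f : EuclideanSpace ℝ (Fin d) × ℝ → ℝ)
    (p : EuclideanSpace ℝ (Fin d) × ℝ) : ℝ :=
  (∑ i : Fin d,
      fderiv ℝ (fun q => fderiv ℝ f q (EuclideanSpace.single i 1, 0)) p
        (EuclideanSpace.single i 1, 0))
    + fderiv ℝ (fun q => fderiv ℝ f q (0, 1)) p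
        ((0 : EuclideanSpace ℝ (Fin d)), (1 : ℝ))
    + γ / p.2 * fderiv ℝ f p ((0 : EuclideanSpace ℝ (Fin d)), (1 : ℝ))

/-- The `d+1` coordinate directions of `ℝ^d × ℝ`: the first `d` are the `x`-directions,
the last one is the `ξ`-direction. -/
noncomputable def dir (d : ℕ) (i : Fin (d + 1)) : EuclideanSpace ℝ (Fin d) × ℝ :=
  if h : (i : ℕ) < d then (EuclideanSpace.single (⟨i, h⟩ : Fin d) 1, 0)
  else ((0 : EuclideanSpace ℝ (Fin d)), (1 : ℝ))

/-- The extended potential `𝒦_{μ,β}(x,ξ) = ∫ |(x-y,ξ)|^{-β} μ(y) dy` on the upper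
half-space, where `|(z,ξ)| = (|z|² + ξ²)^{1/2}`. -/
noncomputable def Kext (d : ℕ) (β : ℝ) (μ : EuclideanSpace ℝ (Fin d) → ℝ)
    (p : EuclideanSpace ℝ (Fin d) × ℝ) : ℝ :=
  ∫ y, (‖p.1 - y‖ ^ 2 + p.2 ^ 2) ^ (-β / 2) * μ y

theorem integrable_smul_of_hasCompactSupport {d : ℕ}
    {F : Type*} [NormedAddCommGroup F] [NormedSpace ℝ F]
    {μ : EuclideanSpace ℝ (Fin d) → ℝ}
    (hμ : Continuous μ) (hs : HasCompactSupport μ) {g : EuclideanSpace ℝ (Fin d) → F}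
    (hg : Continuous g) : Integrable (fun y => μ y • g y) :=
  (hμ.smul hg).integrable_of_hasCompactSupport hs.smul_right

theorem continuous_kernel {d : ℕ} (p : EuclideanSpace ℝ (Fin d) × ℝ) (hp : 0 < p.2) (b : ℝ) :
    Continuous fun y : EuclideanSpace ℝ (Fin d) => (‖p.1 - y‖ ^ 2 + p.2 ^ 2) ^ b :=
  Continuous.rpow_const (by fun_prop) fun y => Or.inl (by positivity)

theorem integrable_kernel_mul {d : ℕ} {μ : EuclideanSpace ℝ (Fin d) → ℝ}
    (hμ : Continuous μ) (hs : HasCompactSupport μ) (p : EuclideanSpace ℝ (Fin d) × ℝ)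
    (hp : 0 < p.2) (b : ℝ) :
    Integrable fun y => (‖p.1 - y‖ ^ 2 + p.2 ^ 2) ^ b * μ y := by
  simpa [mul_comm] using
    integrable_smul_of_hasCompactSupport hμ hs (continuous_kernel p hp b)

/-- The derivative in the variable `p` of the kernel `|(p.1 - y, p.2)|^{-β}`. -/
noncomputable def kernelDeriv (d : ℕ) (β : ℝ) (p : EuclideanSpace ℝ (Fin d) × ℝ)
    (y : EuclideanSpace ℝ (Fin d)) : EuclideanSpace ℝ (Fin d) × ℝ →L[ℝ] ℝ :=
  (-β * (‖p.1 - y‖ ^ 2 + p.2 ^ 2) ^ (-(β + 2) / 2)) •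
    ((innerSL ℝ (p.1 - y)).comp (ContinuousLinearMap.fst ℝ _ _)
      + p.2 • ContinuousLinearMap.snd ℝ _ _)

theorem kernelDeriv_apply (d : ℕ) (β : ℝ) (p : EuclideanSpace ℝ (Fin d) × ℝ)
    (y : EuclideanSpace ℝ (Fin d)) (w : EuclideanSpace ℝ (Fin d) × ℝ) :
    kernelDeriv d β p y w = -β * (‖p.1 - y‖ ^ 2 + p.2 ^ 2) ^ (-(β + 2) / 2) *
      (inner ℝ (p.1 - y) w.1 + p.2 * w.2) := by
  simp only [kernelDeriv, smul_apply, add_apply, ContinuousLinearMap.comp_apply,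
    ContinuousLinearMap.coe_fst', ContinuousLinearMap.coe_snd', innerSL_apply_apply, smul_eq_mul]

theorem hasFDerivAt_kernel {d : ℕ} (β : ℝ) (p : EuclideanSpace ℝ (Fin d) × ℝ) (hp : 0 < p.2)
    (y : EuclideanSpace ℝ (Fin d)) :
    HasFDerivAt (fun q : EuclideanSpace ℝ (Fin d) × ℝ => (‖q.1 - y‖ ^ 2 + q.2 ^ 2) ^ (-β / 2))
      (kernelDeriv d β p y) p := by
  have h1 : HasFDerivAt (fun q : EuclideanSpace ℝ (Fin d) × ℝ => q.1 - y)
      (ContinuousLinearMap.fst ℝ (EuclideanSpace ℝ (Fin d)) ℝ) p := hasFDerivAt_fst.sub_const y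
  have h2 : HasFDerivAt (fun q : EuclideanSpace ℝ (Fin d) × ℝ => q.2)
      (ContinuousLinearMap.snd ℝ (EuclideanSpace ℝ (Fin d)) ℝ) p := hasFDerivAt_snd
  have hN : ‖p.1 - y‖ ^ 2 + p.2 ^ 2 ≠ 0 := by positivity
  refine ((h1.norm_sq.add (h2.pow 2)).rpow_const (p := -β / 2) (Or.inl hN)).congr_fderiv ?_
  ext w <;> simp only [kernelDeriv] <;> simp <;>
    rw [show -β / 2 - 1 = (-2 + -β) / 2 by ring] <;> ring

theorem norm_kernelDeriv_le {d : ℕ} {β : ℝ} (hβ : 0 < β) {ε : ℝ} (hε : 0 < ε)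
    (p : EuclideanSpace ℝ (Fin d) × ℝ) (hp : ε ≤ p.2) (y : EuclideanSpace ℝ (Fin d)) :
    ‖kernelDeriv d β p y‖ ≤ β * (ε ^ 2) ^ (-(β + 2) / 2) * (‖p.1 - y‖ + p.2) := by
  have hp0 : 0 < p.2 := hε.trans_le hp
  refine ContinuousLinearMap.opNorm_le_bound _ (by positivity) fun w => ?_
  rw [kernelDeriv_apply, norm_mul, norm_mul, norm_neg, Real.norm_of_nonneg hβ.le,
    Real.norm_of_nonneg (by positivity), mul_assoc _ (‖p.1 - y‖ + p.2)]
  gcongr ?_ * ?_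
  · gcongr ?_ * ?_
    refine Real.rpow_le_rpow_of_nonpos (by positivity) ?_ (by linarith)
    nlinarith [sq_nonneg ‖p.1 - y‖]
  · calc ‖inner ℝ (p.1 - y) w.1 + p.2 * w.2‖ ≤ ‖p.1 - y‖ * ‖w.1‖ + p.2 * ‖w.2‖ := by
          refine (norm_add_le _ _).trans (add_le_add (norm_inner_le_norm _ _) ?_)
          rw [norm_mul, Real.norm_of_nonneg hp0.le]
      _ ≤ ‖p.1 - y‖ * ‖w‖ + p.2 * ‖w‖ := by
          gcongr
          · exact norm_fst_le w
          · exact norm_snd_le w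
      _ = _ := by ring

theorem hasFDerivAt_Kext {d : ℕ} {β : ℝ} (hβ : 0 < β) {μ : EuclideanSpace ℝ (Fin d) → ℝ}
    (hμ : Continuous μ) (hs : HasCompactSupport μ) (p : EuclideanSpace ℝ (Fin d) × ℝ)
    (hp : 0 < p.2) :
    HasFDerivAt (Kext d β μ) (∫ y, μ y • kernelDeriv d β p y) p ∧
      Integrable (fun y => μ y • kernelDeriv d β p y) := by
  have hpos : ∀ᶠ q : EuclideanSpace ℝ (Fin d) × ℝ in nhds p, 0 < q.2 :=
    (isOpen_lt continuous_const continuous_snd).mem_nhds hp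
  have hcont : Continuous fun y => kernelDeriv d β p y := by
    have := continuous_kernel p hp (-(β + 2) / 2)
    unfold kernelDeriv
    fun_prop
  have hint := integrable_smul_of_hasCompactSupport hμ hs hcont
  refine ⟨?_, hint⟩
  unfold Kext
  set ε := p.2 / 2 with hεdef
  have hε : 0 < ε := by positivity
  have hball : ∀ q ∈ Metric.ball p ε, ε ≤ q.2 ∧ q.2 ≤ p.2 + ε ∧ ‖q.1 - p.1‖ ≤ ε := by
    intro q hq
    rw [Metric.mem_ball, dist_eq_norm] at hq
    have h1 := (norm_fst_le (q - p)).trans hq.le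
    have h2 := (norm_snd_le (q - p)).trans hq.le
    rw [Real.norm_eq_abs, abs_le] at h2
    simp only [Prod.snd_sub, Prod.fst_sub] at h1 h2
    exact ⟨by linarith [h2.1], by linarith [h2.2], h1⟩
  refine hasFDerivAt_integral_of_dominated_of_fderiv_le (s := Metric.ball p ε)
    (F := fun (q : EuclideanSpace ℝ (Fin d) × ℝ) y => (‖q.1 - y‖ ^ 2 + q.2 ^ 2) ^ (-β / 2) * μ y)
    (F' := fun q y => μ y • kernelDeriv d β q y)
    (bound := fun y => ‖μ y • (β * (ε ^ 2) ^ (-(β + 2) / 2) * (ε + ‖p.1 - y‖ + (p.2 + ε)))‖)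
    (Metric.ball_mem_nhds p hε) ?_ (integrable_kernel_mul hμ hs p hp _) hint.1 ?_ ?_ ?_
  · filter_upwards [hpos] with q hq using (integrable_kernel_mul hμ hs q hq _).1
  · refine Filter.Eventually.of_forall fun y q hq => ?_
    obtain ⟨h1, h2, h3⟩ := hball q hq
    rw [norm_smul, norm_smul]
    gcongr
    refine (norm_kernelDeriv_le hβ hε q h1 y).trans (le_trans ?_ (le_abs_self _))
    gcongr
    calc ‖q.1 - y‖ = ‖(q.1 - p.1) + (p.1 - y)‖ := by congr 1; abel
      _ ≤ ε + ‖p.1 - y‖ := (norm_add_le _ _).trans (by gcongr)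
  · exact (integrable_smul_of_hasCompactSupport hμ hs (by fun_prop)).norm
  · refine Filter.Eventually.of_forall fun y q hq => ?_
    have := (hasFDerivAt_kernel β q (hε.trans_le (hball q hq).1) y).mul_const (μ y)
    simpa using this

theorem fderiv_Kext_apply {d : ℕ} {β : ℝ} (hβ : 0 < β) {μ : EuclideanSpace ℝ (Fin d) → ℝ}
    (hμ : Continuous μ) (hs : HasCompactSupport μ) (p : EuclideanSpace ℝ (Fin d) × ℝ)
    (hp : 0 < p.2) (w : EuclideanSpace ℝ (Fin d) × ℝ) :
    fderiv ℝ (Kext d β μ) p w = -β * ∫ y, (‖p.1 - y‖ ^ 2 + p.2 ^ 2) ^ (-(β + 2) / 2) *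
      (inner ℝ (p.1 - y) w.1 + p.2 * w.2) * μ y := by
  obtain ⟨h, hint⟩ := hasFDerivAt_Kext hβ hμ hs p hp
  rw [h.fderiv, ContinuousLinearMap.integral_apply hint, ← integral_const_mul]
  refine integral_congr_ae (Filter.Eventually.of_forall fun y => ?_)
  simp only [smul_apply, kernelDeriv_apply, smul_eq_mul]
  ring

theorem fderiv_Kext_apply_eq {d : ℕ} {β : ℝ} (hβ : 0 < β) {μ : EuclideanSpace ℝ (Fin d) → ℝ}
    (hμ : Continuous μ) (hs : HasCompactSupport μ) (p : EuclideanSpace ℝ (Fin d) × ℝ)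
    (hp : 0 < p.2) (w : EuclideanSpace ℝ (Fin d) × ℝ) :
    fderiv ℝ (Kext d β μ) p w = -β * ((inner ℝ p.1 w.1 + p.2 * w.2) * Kext d (β + 2) μ p
      - Kext d (β + 2) (fun y => inner ℝ y w.1 * μ y) p) := by
  rw [fderiv_Kext_apply hβ hμ hs p hp]
  simp only [Kext]
  have h2 := integrable_kernel_mul (μ := fun y => inner ℝ y w.1 * μ y) (by fun_prop)
    hs.mul_left p hp (-(β + 2) / 2)
  rw [← integral_const_mul (inner ℝ p.1 w.1 + p.2 * w.2),
    ← integral_sub ((integrable_kernel_mul hμ hs p hp _).const_mul _) h2]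
  congr 2
  ext y
  rw [inner_sub_left]
  ring

theorem fderiv_fderiv_Kext {d : ℕ} {β : ℝ} (hβ : 0 < β) {μ : EuclideanSpace ℝ (Fin d) → ℝ}
    (hμ : Continuous μ) (hs : HasCompactSupport μ) (p : EuclideanSpace ℝ (Fin d) × ℝ)
    (hp : 0 < p.2) (w : EuclideanSpace ℝ (Fin d) × ℝ) :
    fderiv ℝ (fun q => fderiv ℝ (Kext d β μ) q w) p w =
      -β * ((‖w.1‖ ^ 2 + w.2 ^ 2) * Kext d (β + 2) μ p
        - (β + 2) * ∫ y, (‖p.1 - y‖ ^ 2 + p.2 ^ 2) ^ (-(β + 4) / 2) *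
          (inner ℝ (p.1 - y) w.1 + p.2 * w.2) ^ 2 * μ y) := by
  have hpos : ∀ᶠ q : EuclideanSpace ℝ (Fin d) × ℝ in nhds p, 0 < q.2 :=
    (isOpen_lt continuous_const continuous_snd).mem_nhds hp
  have heq : (fun q => fderiv ℝ (Kext d β μ) q w) =ᶠ[nhds p] fun q =>
      -β * ((inner ℝ q.1 w.1 + q.2 * w.2) * Kext d (β + 2) μ q
      - Kext d (β + 2) (fun y => inner ℝ y w.1 * μ y) q) := by
    filter_upwards [hpos] with q hq using fderiv_Kext_apply_eq hβ hμ hs q hq w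
  have hν : Continuous fun y => inner ℝ y w.1 * μ y := by fun_prop
  have hνs : HasCompactSupport fun y => inner ℝ y w.1 * μ y := hs.mul_left
  have hβ2 : 0 < β + 2 := by linarith
  have d1 := (hasFDerivAt_Kext hβ2 hμ hs p hp).1.differentiableAt.hasFDerivAt
  have d2 := (hasFDerivAt_Kext hβ2 hν hνs p hp).1.differentiableAt.hasFDerivAt
  have d3 : HasFDerivAt (fun q : EuclideanSpace ℝ (Fin d) × ℝ => inner ℝ q.1 w.1 + q.2 * w.2)
      ((innerSL ℝ w.1).comp (ContinuousLinearMap.fst ℝ _ _)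
        + w.2 • ContinuousLinearMap.snd ℝ _ _) p := by
    have := ((innerSL ℝ w.1).comp (ContinuousLinearMap.fst ℝ _ _)
        + w.2 • ContinuousLinearMap.snd ℝ _ _).hasFDerivAt (x := p)
    refine this.congr_of_eventuallyEq (Filter.Eventually.of_forall fun q => ?_)
    simp [real_inner_comm, mul_comm]
  have d4 := ((d3.mul d1).sub d2).const_mul (-β)
  have e4 : fderiv ℝ (fun q : EuclideanSpace ℝ (Fin d) × ℝ =>
      -β * ((inner ℝ q.1 w.1 + q.2 * w.2) * Kext d (β + 2) μ q
      - Kext d (β + 2) (fun y => inner ℝ y w.1 * μ y) q)) p = _ := d4.fderiv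
  rw [heq.fderiv_eq, e4]
  simp only [smul_apply, sub_apply,
    add_apply, smul_eq_mul, ContinuousLinearMap.comp_apply,
    ContinuousLinearMap.coe_fst', ContinuousLinearMap.coe_snd', innerSL_apply_apply]
  rw [fderiv_Kext_apply hβ2 hμ hs p hp, fderiv_Kext_apply hβ2 hν hνs p hp,
    real_inner_self_eq_norm_sq]
  have hc : Continuous fun y => (‖p.1 - y‖ ^ 2 + p.2 ^ 2) ^ (-(β + 2 + 2) / 2) *
      (inner ℝ (p.1 - y) w.1 + p.2 * w.2) := by
    have := continuous_kernel p hp (-(β + 2 + 2) / 2)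
    fun_prop
  have i1 := integrable_smul_of_hasCompactSupport hμ hs hc
  have i2 := integrable_smul_of_hasCompactSupport hν hνs hc
  simp only [smul_eq_mul, mul_comm (μ _)] at i1
  simp only [smul_eq_mul, mul_comm (_ * μ _)] at i2
  have key : ∫ y, (‖p.1 - y‖ ^ 2 + p.2 ^ 2) ^ (-(β + 4) / 2) *
          (inner ℝ (p.1 - y) w.1 + p.2 * w.2) ^ 2 * μ y
      = (inner ℝ p.1 w.1 + p.2 * w.2) * (∫ y, (‖p.1 - y‖ ^ 2 + p.2 ^ 2) ^ (-(β + 2 + 2) / 2) *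
          (inner ℝ (p.1 - y) w.1 + p.2 * w.2) * μ y)
        - ∫ y, (‖p.1 - y‖ ^ 2 + p.2 ^ 2) ^ (-(β + 2 + 2) / 2) *
          (inner ℝ (p.1 - y) w.1 + p.2 * w.2) * (inner ℝ y w.1 * μ y) := by
    rw [← integral_const_mul, ← integral_sub (i1.const_mul _) i2]
    congr 1
    ext y
    rw [show -(β + 2 + 2) / 2 = -(β + 4) / 2 by ring, inner_sub_left]
    ring
  rw [key]
  ring

theorem dgamma_Kext {d : ℕ} (γ : ℝ) {β : ℝ} (hβ : 0 < β) {μ : EuclideanSpace ℝ (Fin d) → ℝ}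
    (hμ : Continuous μ) (hs : HasCompactSupport μ) (p : EuclideanSpace ℝ (Fin d) × ℝ)
    (hp : 0 < p.2) :
    dgamma d γ (Kext d β μ) p = β * (β + 1 - d - γ) * Kext d (β + 2) μ p := by
  unfold dgamma
  simp only [fderiv_fderiv_Kext hβ hμ hs p hp]
  rw [fderiv_Kext_apply hβ hμ hs p hp]
  have hint : ∀ w : EuclideanSpace ℝ (Fin d) × ℝ, Integrable fun y =>
      (‖p.1 - y‖ ^ 2 + p.2 ^ 2) ^ (-(β + 4) / 2) *
          (inner ℝ (p.1 - y) w.1 + p.2 * w.2) ^ 2 * μ y := by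
    intro w
    have hc : Continuous fun y => (‖p.1 - y‖ ^ 2 + p.2 ^ 2) ^ (-(β + 4) / 2) *
        (inner ℝ (p.1 - y) w.1 + p.2 * w.2) ^ 2 := by
      have := continuous_kernel p hp (-(β + 4) / 2)
      fun_prop
    simpa only [smul_eq_mul, mul_comm (μ _)] using
      integrable_smul_of_hasCompactSupport hμ hs hc
  have key : (∑ i : Fin d, ∫ y, (‖p.1 - y‖ ^ 2 + p.2 ^ 2) ^ (-(β + 4) / 2) *
          (inner ℝ (p.1 - y) (EuclideanSpace.single i (1 : ℝ)) + p.2 * 0) ^ 2 * μ y)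
      + (∫ y, (‖p.1 - y‖ ^ 2 + p.2 ^ 2) ^ (-(β + 4) / 2) *
          (inner ℝ (p.1 - y) (0 : EuclideanSpace ℝ (Fin d)) + p.2 * 1) ^ 2 * μ y)
      = Kext d (β + 2) μ p := by
    rw [← integral_finsetSum _ fun i _ => hint (EuclideanSpace.single i (1 : ℝ), 0),
      ← integral_add (integrable_finsetSum _ fun i _ => hint (EuclideanSpace.single i (1 : ℝ), 0))
        (hint (0, 1))]
    unfold Kext
    congr 1
    ext y
    have hN : 0 < ‖p.1 - y‖ ^ 2 + p.2 ^ 2 := by positivity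
    rw [← Finset.sum_mul, ← Finset.mul_sum,
      show -(β + 2) / 2 = -(β + 4) / 2 + 1 by ring, Real.rpow_add hN, Real.rpow_one,
      ← add_mul, ← mul_add]
    congr 2
    rw [EuclideanSpace.norm_sq_eq]
    simp [EuclideanSpace.inner_single_right]
  have key2 : (∫ y, (‖p.1 - y‖ ^ 2 + p.2 ^ 2) ^ (-(β + 2) / 2) *
      (inner ℝ (p.1 - y) (0 : EuclideanSpace ℝ (Fin d)) + p.2 * 1) * μ y)
      = p.2 * Kext d (β + 2) μ p := by
    unfold Kext
    rw [← integral_const_mul]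
    congr 1
    ext y
    simp
    ring
  rw [key2, ← Finset.mul_sum, Finset.sum_sub_distrib, ← Finset.mul_sum]
  rw [← eq_sub_iff_add_eq] at key
  rw [key]
  simp
  field_simp
  ring

theorem fderiv_eq_const_mul_of_eqOn {d : ℕ} {f g : EuclideanSpace ℝ (Fin d) × ℝ → ℝ} {C : ℝ}
    (h : ∀ p : EuclideanSpace ℝ (Fin d) × ℝ, 0 < p.2 → f p = C * g p)
    (p : EuclideanSpace ℝ (Fin d) × ℝ) (hp : 0 < p.2) (w : EuclideanSpace ℝ (Fin d) × ℝ) :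
    fderiv ℝ f p w = C * fderiv ℝ g p w := by
  have heq : f =ᶠ[nhds p] C • g := by
    filter_upwards [(isOpen_lt continuous_const continuous_snd).mem_nhds hp] with q hq using h q hq
  rw [heq.fderiv_eq, fderiv_const_smul_field]
  rfl

theorem dgamma_eq_const_mul_of_eqOn {d : ℕ} (γ : ℝ) {f g : EuclideanSpace ℝ (Fin d) × ℝ → ℝ}
    {C : ℝ} (h : ∀ p : EuclideanSpace ℝ (Fin d) × ℝ, 0 < p.2 → f p = C * g p)
    (p : EuclideanSpace ℝ (Fin d) × ℝ) (hp : 0 < p.2) :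
    dgamma d γ f p = C * dgamma d γ g p := by
  have h1 := fun w => fderiv_eq_const_mul_of_eqOn h p hp w
  have h2 := fun w => fderiv_eq_const_mul_of_eqOn
    (fun q hq => fderiv_eq_const_mul_of_eqOn h q hq w) p hp w
  simp only [dgamma, h1, h2, ← Finset.mul_sum]
  ring

theorem iterate_dgamma_Kext {d : ℕ} (γ : ℝ) {α : ℝ} (hα : 0 < α)
    {μ : EuclideanSpace ℝ (Fin d) → ℝ} (hμ : Continuous μ) (hs : HasCompactSupport μ) (k : ℕ)
    (p : EuclideanSpace ℝ (Fin d) × ℝ) (hp : 0 < p.2) :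
    (dgamma d γ)^[k] (Kext d α μ) p =
      (∏ i ∈ Finset.range k, (α + 2 * i) * (α + 2 * i + 1 - d - γ)) *
        Kext d (α + 2 * k) μ p := by
  induction k generalizing p with
  | zero => simp
  | succ k ih =>
    rw [Function.iterate_succ_apply', dgamma_eq_const_mul_of_eqOn γ ih p hp,
      dgamma_Kext γ (by positivity) hμ hs p hp, Finset.prod_range_succ]
    push_cast
    rw [show α + 2 * (k + 1 : ℝ) = α + 2 * k + 2 by ring]
    ring

theorem ae_ne_of_pos {d : ℕ} (hd : 0 < d) (x : EuclideanSpace ℝ (Fin d)) :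
    ∀ᵐ y : EuclideanSpace ℝ (Fin d), y ≠ x := by
  have : Nonempty (Fin d) := ⟨⟨0, hd⟩⟩
  exact compl_mem_ae_iff.2 (measure_singleton x)

theorem exists_riesz_potential_le {d : ℕ} (hd : 0 < d) {b : ℝ} (hb : 0 < b) (hbd : b < d)
    {μ : EuclideanSpace ℝ (Fin d) → ℝ} (hμ : Continuous μ) (hs : HasCompactSupport μ) :
    ∃ C : ℝ, ∀ x, Integrable (fun y => ‖x - y‖ ^ (-b) * |μ y|) ∧
      ∫ y, ‖x - y‖ ^ (-b) * |μ y| ≤ C := by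
  have : Nonempty (Fin d) := ⟨⟨0, hd⟩⟩
  obtain ⟨B, hB⟩ := hs.exists_bound_of_continuous hμ
  have hB0 : 0 ≤ B := (norm_nonneg _).trans (hB 0)
  set G : EuclideanSpace ℝ (Fin d) → ℝ := (Metric.ball 0 1).indicator fun z => ‖z‖ ^ (-b) with hG
  have hGint : Integrable G := by
    rw [hG, integrable_indicator_iff Metric.isOpen_ball.measurableSet]
    refine integrableOn_ball_of_norm_le_rpow (C := 1) (α := b) ?_ ?_
      (Filter.Eventually.of_forall fun z => ?_) ?_
    · simpa using Nat.one_le_of_lt hd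
    · simpa using hbd
    · rw [one_mul, Real.norm_of_nonneg (by positivity)]
    · exact Measurable.aestronglyMeasurable (by fun_prop)
  have hle : ∀ z, ‖z‖ ^ (-b) ≤ G z + 1 := by
    intro z
    by_cases hz : z ∈ Metric.ball (0 : EuclideanSpace ℝ (Fin d)) 1
    · simp [hG, hz]
    · have : 1 ≤ ‖z‖ := by simpa using hz
      simpa [hG, hz] using Real.rpow_le_one_of_one_le_of_nonpos this (by linarith)
  have hμi : Integrable fun y => |μ y| := (hμ.integrable_of_hasCompactSupport hs).abs
  have hG0 : ∀ z, 0 ≤ G z := fun z => Set.indicator_nonneg (fun _ _ => by positivity) z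
  have hpt : ∀ x y, ‖x - y‖ ^ (-b) * |μ y| ≤ B * G (x - y) + |μ y| := by
    intro x y
    have h1 := hB y
    rw [Real.norm_eq_abs] at h1
    nlinarith [mul_le_mul_of_nonneg_right (hle (x - y)) (abs_nonneg (μ y)),
      mul_le_mul_of_nonneg_right h1 (hG0 (x - y))]
  have hdom : ∀ x, Integrable fun y => B * G (x - y) + |μ y| := fun x =>
    ((hGint.comp_sub_left x).const_mul B).add hμi
  have hint : ∀ x, Integrable (fun y => ‖x - y‖ ^ (-b) * |μ y|) := by
    intro x
    refine (hdom x).mono' (Measurable.aestronglyMeasurable (by fun_prop))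
      (Filter.Eventually.of_forall fun y => ?_)
    rw [Real.norm_of_nonneg (by positivity)]
    exact hpt x y
  refine ⟨B * (∫ z, G z) + ∫ y, |μ y|, fun x => ⟨hint x, ?_⟩⟩
  refine (integral_mono (hint x) (hdom x) (hpt x)).trans_eq ?_
  rw [integral_add ((hGint.comp_sub_left x).const_mul B) hμi, integral_const_mul,
    integral_sub_left_eq_self]

theorem exists_riesz_potential_decay {d : ℕ} (hd : 0 < d) {b : ℝ} (hb : 0 < b) (hbd : b < d)
    {μ : EuclideanSpace ℝ (Fin d) → ℝ} (hμ : Continuous μ) (hs : HasCompactSupport μ) :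
    ∃ C : ℝ, ∀ x, Integrable (fun y => ‖x - y‖ ^ (-b) * |μ y|) ∧
      ∫ y, ‖x - y‖ ^ (-b) * |μ y| ≤ C * (1 + ‖x‖) ^ (-b) := by
  obtain ⟨C, hC⟩ := exists_riesz_potential_le hd hb hbd hμ hs
  obtain ⟨R, hR, hsupp⟩ := hs.isCompact.isBounded.exists_pos_norm_le
  have hμi : Integrable fun y => |μ y| := (hμ.integrable_of_hasCompactSupport hs).abs
  set D : ℝ := (2 * (1 + R)) ^ b with hD
  have hpt : ∀ x y, (1 + ‖x‖) ^ b * (‖x - y‖ ^ (-b) * |μ y|)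
      ≤ D * (‖x - y‖ ^ (-b) * |μ y| + |μ y|) := by
    intro x y
    by_cases hy : μ y = 0
    · simp [hy]
    have hyR : ‖y‖ ≤ R := hsupp y (subset_tsupport _ hy)
    rw [← mul_assoc, ← add_one_mul, ← mul_assoc]
    refine mul_le_mul_of_nonneg_right ?_ (abs_nonneg _)
    rcases eq_or_ne x y with rfl | hxy
    · rw [sub_self, norm_zero, Real.zero_rpow (by linarith)]
      simp only [mul_zero, zero_add, mul_one]
      positivity
    have ht : 0 < ‖x - y‖ := norm_pos_iff.2 (sub_ne_zero.2 hxy)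
    have hx : ‖x‖ ≤ ‖x - y‖ + ‖y‖ := norm_le_norm_sub_add x y
    rcases le_total ‖x - y‖ (1 + R) with h | h
    · have h1 : (1 + ‖x‖) ^ b ≤ D := Real.rpow_le_rpow (by positivity) (by linarith) hb.le
      nlinarith [mul_le_mul_of_nonneg_right h1 (Real.rpow_nonneg ht.le (-b)),
        Real.rpow_nonneg (show 0 ≤ 2 * (1 + R) by positivity) b]
    · have h1 : (1 + ‖x‖) ^ b ≤ (2 * ‖x - y‖) ^ b :=
        Real.rpow_le_rpow (by positivity) (by linarith) hb.le
      have h2 : (2 * ‖x - y‖) ^ b * ‖x - y‖ ^ (-b) = 2 ^ b := by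
        rw [Real.mul_rpow (by norm_num) ht.le, mul_assoc, ← Real.rpow_add ht]
        simp
      have h3 : (2 : ℝ) ^ b ≤ D := Real.rpow_le_rpow (by norm_num) (by linarith) hb.le
      nlinarith [mul_le_mul_of_nonneg_right h1 (Real.rpow_nonneg ht.le (-b)),
        mul_nonneg (Real.rpow_nonneg (show 0 ≤ 2 * (1 + R) by positivity) b)
          (Real.rpow_nonneg ht.le (-b))]
  refine ⟨D * (C + ∫ y, |μ y|), fun x => ⟨(hC x).1, ?_⟩⟩
  have hx : 0 < 1 + ‖x‖ := by positivity
  rw [Real.rpow_neg hx.le, ← div_eq_mul_inv, le_div_iff₀ (by positivity), mul_comm,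
    ← integral_const_mul]
  refine (integral_mono ((hC x).1.const_mul _) (((hC x).1.add hμi).const_mul D) (hpt x)).trans ?_
  simp only [Pi.add_apply]
  rw [integral_const_mul, integral_add (hC x).1 hμi]
  gcongr
  exact (hC x).2

theorem exists_Kext_abs_le {d : ℕ} (hd : 0 < d) {s a : ℝ} (ha : 0 ≤ a) (hb : 0 < s - a)
    (hbd : s - a < d) {μ : EuclideanSpace ℝ (Fin d) → ℝ} (hμ : Continuous μ)
    (hs : HasCompactSupport μ) :
    ∃ C : ℝ, ∀ p : EuclideanSpace ℝ (Fin d) × ℝ, 0 < p.2 →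
      Kext d s (fun y => |μ y|) p ≤ C * (p.2 ^ (-a) * (1 + ‖p.1‖) ^ (-(s - a))) := by
  obtain ⟨C, hC⟩ := exists_riesz_potential_decay hd hb hbd hμ hs
  refine ⟨C, fun p hp => ?_⟩
  have hle : Kext d s (fun y => |μ y|) p ≤ ∫ y, p.2 ^ (-a) * (‖p.1 - y‖ ^ (-(s - a)) * |μ y|) := by
    refine integral_mono_ae (integrable_kernel_mul hμ.abs hs.norm p hp _)
      ((hC p.1).1.const_mul _) ?_
    filter_upwards [ae_ne_of_pos hd p.1] with y hy
    have ht : 0 < ‖p.1 - y‖ := norm_pos_iff.2 (sub_ne_zero.2 hy.symm)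
    rw [← mul_assoc]
    gcongr
    have hN : 0 < ‖p.1 - y‖ ^ 2 + p.2 ^ 2 := by positivity
    rw [show -s / 2 = -a / 2 + -(s - a) / 2 by ring, Real.rpow_add hN]
    have key : ∀ t c : ℝ, 0 < t → t ^ 2 ≤ ‖p.1 - y‖ ^ 2 + p.2 ^ 2 → 0 ≤ c →
        (‖p.1 - y‖ ^ 2 + p.2 ^ 2) ^ (-c / 2) ≤ t ^ (-c) := by
      intro t c ht0 htN hc
      refine (Real.rpow_le_rpow_of_nonpos (by positivity) htN (by linarith)).trans_eq ?_
      rw [← Real.rpow_natCast, ← Real.rpow_mul ht0.le]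
      congr 1
      push_cast
      ring
    gcongr
    · exact key _ _ hp (by nlinarith [sq_nonneg ‖p.1 - y‖]) ha
    · exact key _ _ ht (by nlinarith [sq_nonneg p.2]) hb.le
  refine hle.trans ?_
  rw [integral_const_mul, mul_left_comm]
  gcongr
  exact (hC p.1).2

theorem volume_restrict_upperHalfSpace (d : ℕ) :
    (volume : Measure (EuclideanSpace ℝ (Fin d) × ℝ)).restrict {p | 0 < p.2}
      = (volume : Measure (EuclideanSpace ℝ (Fin d))).prod (volume.restrict (Set.Ioi (0 : ℝ))) := by
  have h : {p : EuclideanSpace ℝ (Fin d) × ℝ | 0 < p.2} = Set.univ ×ˢ Set.Ioi (0 : ℝ) := by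
    ext p
    simp
  rw [h, Measure.volume_eq_prod, ← Measure.prod_restrict, Measure.restrict_univ]

theorem measurableSet_upperHalfSpace (d : ℕ) :
    MeasurableSet {p : EuclideanSpace ℝ (Fin d) × ℝ | 0 < p.2} :=
  (isOpen_lt continuous_const continuous_snd).measurableSet

theorem integrable_weight_mul_Kext_sq {d : ℕ} (hd : 0 < d) {s γ : ℝ} (hγ : -1 < γ)
    (hs1 : d + γ + 1 < 2 * s) (hs2 : s < d + (γ + 1) / 2)
    {μ : EuclideanSpace ℝ (Fin d) → ℝ} (hμ : Continuous μ) (hs : HasCompactSupport μ) :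
    Integrable (fun p : EuclideanSpace ℝ (Fin d) × ℝ => p.2 ^ γ * Kext d s (fun y => |μ y|) p ^ 2)
      (volume.restrict {p | 0 < p.2}) := by
  have hd' : (0 : ℝ) < d := by exact_mod_cast hd
  obtain ⟨a₁, ha₁, ha₁'⟩ := exists_between
    (show max (s - d) 0 < (γ + 1) / 2 from max_lt (by linarith) (by linarith))
  obtain ⟨a₂, ha₂, ha₂'⟩ := exists_between (show (γ + 1) / 2 < s - d / 2 by linarith)
  rw [max_lt_iff] at ha₁
  obtain ⟨C₁, hC₁⟩ := exists_Kext_abs_le hd (s := s) (a := a₁) ha₁.2.le (by linarith)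
    (by linarith) hμ hs
  obtain ⟨C₂, hC₂⟩ := exists_Kext_abs_le hd (s := s) (a := a₂) (by linarith) (by linarith)
    (by linarith) hμ hs
  have hx : ∀ b : ℝ, d / 2 < b → Integrable fun x : EuclideanSpace ℝ (Fin d) =>
      (1 + ‖x‖) ^ (-(2 * b)) := fun b hb => integrable_one_add_norm (by simp; linarith)
  have hξ₁ : Integrable ((Set.Ioc 0 1).indicator fun ξ : ℝ => ξ ^ (γ - 2 * a₁))
      (volume.restrict (Set.Ioi 0)) := by
    refine Integrable.restrict ?_
    rw [integrable_indicator_iff measurableSet_Ioc,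
      ← intervalIntegrable_iff_integrableOn_Ioc_of_le zero_le_one]
    exact intervalIntegral.intervalIntegrable_rpow' (by linarith)
  have hξ₂ : Integrable ((Set.Ioi 1).indicator fun ξ : ℝ => ξ ^ (γ - 2 * a₂))
      (volume.restrict (Set.Ioi 0)) := by
    refine Integrable.restrict ?_
    rw [integrable_indicator_iff measurableSet_Ioi]
    exact integrableOn_Ioi_rpow_of_lt (by linarith) one_pos
  have hdom := (((hx (s - a₁) (by linarith)).mul_prod hξ₁).const_mul (C₁ ^ 2)).add
    (((hx (s - a₂) (by linarith)).mul_prod hξ₂).const_mul (C₂ ^ 2))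
  rw [← volume_restrict_upperHalfSpace] at hdom
  refine hdom.mono' ?_ ?_
  · refine ContinuousOn.aestronglyMeasurable (fun p hp => ContinuousAt.continuousWithinAt ?_)
      (measurableSet_upperHalfSpace d)
    have hK := (hasFDerivAt_Kext (by linarith : 0 < s) hμ.abs hs.norm p hp).1.continuousAt
    exact (continuousAt_snd.rpow_const (Or.inl (ne_of_gt hp))).mul (hK.pow 2)
  · filter_upwards [ae_restrict_mem (measurableSet_upperHalfSpace d)] with p hp
    have hp : 0 < p.2 := hp
    have hK0 : 0 ≤ Kext d s (fun y => |μ y|) p :=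
      integral_nonneg fun y => by positivity
    rw [Real.norm_of_nonneg (by positivity)]
    have key : ∀ a C : ℝ,
        Kext d s (fun y => |μ y|) p ≤ C * (p.2 ^ (-a) * (1 + ‖p.1‖) ^ (-(s - a))) →
        p.2 ^ γ * Kext d s (fun y => |μ y|) p ^ 2 ≤
          C ^ 2 * ((1 + ‖p.1‖) ^ (-(2 * (s - a))) * p.2 ^ (γ - 2 * a)) := by
      intro a C h
      have hx0 : 0 < 1 + ‖p.1‖ := by positivity
      have h2 := pow_le_pow_left₀ hK0 h 2
      refine (mul_le_mul_of_nonneg_left h2 (by positivity)).trans_eq ?_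
      rw [show γ - 2 * a = γ + -a + -a by ring, show -(2 * (s - a)) = -(s - a) + -(s - a) by ring,
        Real.rpow_add hp, Real.rpow_add hp, Real.rpow_add hx0]
      ring
    simp only [Pi.add_apply]
    rcases le_or_gt p.2 1 with h1 | h1
    · have m1 : p.2 ∈ Set.Ioc (0 : ℝ) 1 := ⟨hp, h1⟩
      have m2 : p.2 ∉ Set.Ioi (1 : ℝ) := by simpa using h1
      rw [Set.indicator_of_mem m1, Set.indicator_of_notMem m2, mul_zero, mul_zero, add_zero]
      exact key a₁ C₁ (hC₁ p hp)
    · have m1 : p.2 ∉ Set.Ioc (0 : ℝ) 1 := fun h => h1.not_ge h.2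
      have m2 : p.2 ∈ Set.Ioi (1 : ℝ) := h1
      rw [Set.indicator_of_notMem m1, Set.indicator_of_mem m2, mul_zero, mul_zero, zero_add]
      exact key a₂ C₂ (hC₂ p hp)

/-- A finite family of kernels on the upper half-space, bounded by and homogeneous like
`|(x,ξ)|^{-s}`, whose quadratic form is invariant under rotations of the variable `x`. -/
structure IsRadialFamily {d : ℕ} {ι : Type*} [Fintype ι] (s : ℝ)
    (k : ι → EuclideanSpace ℝ (Fin d) × ℝ → ℝ) : Prop where
  measurable : ∀ i, Measurable (k i)
  bound : ∃ M : ℝ, ∀ i X, 0 < X.2 → |k i X| ≤ M * (‖X.1‖ ^ 2 + X.2 ^ 2) ^ (-s / 2)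
  homogeneous : ∀ i X (t : ℝ), 0 < t → 0 < X.2 → k i (t • X) = t ^ (-s) * k i X
  rotation : ∀ (R : EuclideanSpace ℝ (Fin d) ≃ₗᵢ[ℝ] EuclideanSpace ℝ (Fin d))
    (X Y : EuclideanSpace ℝ (Fin d) × ℝ),
    ∑ i, k i (R X.1, X.2) * k i (R Y.1, Y.2) = ∑ i, k i X * k i Y

/-- The integrand of the interaction of two unit charges at `v` and at the origin. -/
noncomputable def pairDensity {d : ℕ} {ι : Type*} [Fintype ι] (γ : ℝ)
    (k : ι → EuclideanSpace ℝ (Fin d) × ℝ → ℝ) (v : EuclideanSpace ℝ (Fin d))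
    (p : EuclideanSpace ℝ (Fin d) × ℝ) : ℝ :=
  {p : EuclideanSpace ℝ (Fin d) × ℝ | 0 < p.2}.indicator
    (fun p => p.2 ^ γ * ∑ i, k i (p.1 - v, p.2) * k i p) p

instance isAddHaarMeasure_volume_prod (d : ℕ) :
    (volume : Measure (EuclideanSpace ℝ (Fin d) × ℝ)).IsAddHaarMeasure := by
  rw [Measure.volume_eq_prod]
  infer_instance

theorem IsRadialFamily.integral_pairDensity_rotation {d : ℕ} {ι : Type*} [Fintype ι] {s : ℝ}
    {k : ι → EuclideanSpace ℝ (Fin d) × ℝ → ℝ} (hk : IsRadialFamily s k) (γ : ℝ)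
    (R : EuclideanSpace ℝ (Fin d) ≃ₗᵢ[ℝ] EuclideanSpace ℝ (Fin d))
    (v : EuclideanSpace ℝ (Fin d)) :
    ∫ p, pairDensity γ k (R v) p = ∫ p, pairDensity γ k v p := by
  have hR : MeasurePreserving (Prod.map R (id : ℝ → ℝ)) :=
    R.measurePreserving.prod (MeasurePreserving.id volume)
  have hemb : MeasurableEmbedding (Prod.map R (id : ℝ → ℝ)) :=
    (R.toHomeomorph.prodCongr (Homeomorph.refl ℝ)).measurableEmbedding
  rw [← hR.integral_comp hemb]
  congr 1
  ext p
  have h := hk.rotation R (p.1 - v, p.2) p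
  simp only [map_sub] at h
  by_cases hp : 0 < p.2
  · simp [pairDensity, Set.indicator, hp, ← h, Prod.map]
  · simp [pairDensity, Set.indicator, hp]

theorem IsRadialFamily.integral_pairDensity_smul {d : ℕ} {ι : Type*} [Fintype ι] {s : ℝ}
    {k : ι → EuclideanSpace ℝ (Fin d) × ℝ → ℝ} (hk : IsRadialFamily s k) (γ : ℝ)
    {t : ℝ} (ht : 0 < t) (v : EuclideanSpace ℝ (Fin d)) :
    ∫ p, pairDensity γ k (t • v) p = t ^ (d + 1 + γ - 2 * s) * ∫ p, pairDensity γ k v p := by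
  have h1 := Measure.integral_comp_smul
    (volume : Measure (EuclideanSpace ℝ (Fin d) × ℝ)) (pairDensity γ k (t • v)) t
  have h2 : ∀ p, pairDensity γ k (t • v) (t • p) = t ^ (γ - 2 * s) * pairDensity γ k v p := by
    intro p
    by_cases hp : 0 < p.2
    · have hp' : 0 < t * p.2 := mul_pos ht hp
      have h3 : ∀ i, k i (t • p.1 - t • v, t * p.2) = t ^ (-s) * k i (p.1 - v, p.2) := by
        intro i
        rw [← hk.homogeneous i (p.1 - v, p.2) t ht hp, Prod.smul_mk, smul_sub, smul_eq_mul]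
      simp only [pairDensity, Set.indicator, Set.mem_ofPred_eq, Prod.smul_fst, Prod.smul_snd,
        smul_eq_mul, hp, hp', if_true, h3, hk.homogeneous _ p t ht hp]
      rw [Real.mul_rpow ht.le hp.le, show γ - 2 * s = γ + -s + -s by ring, Real.rpow_add ht,
        Real.rpow_add ht, Finset.mul_sum, Finset.mul_sum, Finset.mul_sum]
      refine Finset.sum_congr rfl fun i _ => ?_
      ring
    · have hp' : ¬ 0 < t * p.2 := fun h => hp (pos_of_mul_pos_right h ht.le)
      simp [pairDensity, Set.indicator, hp, hp']
  simp only [h2, integral_const_mul] at h1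
  have hfr : Module.finrank ℝ (EuclideanSpace ℝ (Fin d) × ℝ) = d + 1 := by simp
  rw [hfr, abs_of_pos (by positivity), smul_eq_mul, eq_inv_mul_iff_mul_eq₀ (by positivity)] at h1
  rw [← h1, ← mul_assoc, ← Real.rpow_natCast, ← Real.rpow_add ht]
  congr 2
  push_cast
  ring

theorem IsRadialFamily.integral_pairDensity_eq {d : ℕ} {ι : Type*} [Fintype ι] {s : ℝ}
    {k : ι → EuclideanSpace ℝ (Fin d) × ℝ → ℝ} (hk : IsRadialFamily s k) (γ : ℝ)
    {e v : EuclideanSpace ℝ (Fin d)} (he : ‖e‖ = 1) (hv : v ≠ 0) :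
    ∫ p, pairDensity γ k v p = ‖v‖ ^ (d + 1 + γ - 2 * s) * ∫ p, pairDensity γ k e p := by
  have hv0 : 0 < ‖v‖ := norm_pos_iff.2 hv
  have hw : ‖e‖ = ‖‖v‖⁻¹ • v‖ := by
    rw [norm_smul, norm_inv, norm_norm, inv_mul_cancel₀ hv0.ne', he]
  have hrot := hk.integral_pairDensity_rotation γ
    ((Submodule.span ℝ {e - ‖v‖⁻¹ • v})ᗮ.reflection) e
  rw [Submodule.reflection_sub hw] at hrot
  rw [← hrot, ← hk.integral_pairDensity_smul γ hv0, smul_inv_smul₀ hv0.ne']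

theorem IsRadialFamily.integral_pair_eq {d : ℕ} {ι : Type*} [Fintype ι] {s : ℝ}
    {k : ι → EuclideanSpace ℝ (Fin d) × ℝ → ℝ} (hk : IsRadialFamily s k) (γ : ℝ)
    {e y z : EuclideanSpace ℝ (Fin d)} (he : ‖e‖ = 1) (hyz : y ≠ z) :
    ∫ p in {p : EuclideanSpace ℝ (Fin d) × ℝ | 0 < p.2},
        p.2 ^ γ * ∑ i, k i (p.1 - y, p.2) * k i (p.1 - z, p.2)
      = ‖y - z‖ ^ (d + 1 + γ - 2 * s) * ∫ p, pairDensity γ k e p := by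
  rw [← hk.integral_pairDensity_eq γ he (sub_ne_zero.2 hyz),
    ← integral_indicator (measurableSet_upperHalfSpace d),
    ← integral_sub_right_eq_self (pairDensity γ k (y - z)) (z, 0)]
  congr 1
  ext p
  have h : p.1 - z - (y - z) = p.1 - y := by abel
  by_cases hp : 0 < p.2 <;> simp [pairDensity, Set.indicator, hp, Prod.sub_def, h]

theorem IsRadialFamily.integrable_kernel {d : ℕ} {ι : Type*} [Fintype ι] {s : ℝ}
    {k : ι → EuclideanSpace ℝ (Fin d) × ℝ → ℝ} (hk : IsRadialFamily s k)
    {μ : EuclideanSpace ℝ (Fin d) → ℝ} (hμ : Continuous μ) (hs : HasCompactSupport μ) (i : ι)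
    {p : EuclideanSpace ℝ (Fin d) × ℝ} (hp : 0 < p.2) :
    Integrable fun y => k i (p.1 - y, p.2) * μ y := by
  obtain ⟨M, hM⟩ := hk.bound
  have := hk.measurable i
  refine ((integrable_kernel_mul hμ hs p hp (-s / 2)).norm.const_mul M).mono'
    (Measurable.aestronglyMeasurable (by fun_prop)) (Filter.Eventually.of_forall fun y => ?_)
  rw [norm_mul, norm_mul, Real.norm_of_nonneg (by positivity : 0 ≤ (_ : ℝ) ^ (-s / 2)),
    ← mul_assoc]
  exact mul_le_mul_of_nonneg_right (hM i _ hp) (norm_nonneg _)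

theorem integrable_kernel_sq_prod {d : ℕ} (hd : 0 < d) {s γ : ℝ} (hγ : -1 < γ)
    (hs1 : d + γ + 1 < 2 * s) (hs2 : s < d + (γ + 1) / 2)
    {μ : EuclideanSpace ℝ (Fin d) → ℝ} (hμ : Continuous μ) (hs : HasCompactSupport μ) :
    Integrable (fun z : (EuclideanSpace ℝ (Fin d) × ℝ) ×
        (EuclideanSpace ℝ (Fin d) × EuclideanSpace ℝ (Fin d)) =>
      z.1.2 ^ γ * (((‖z.1.1 - z.2.1‖ ^ 2 + z.1.2 ^ 2) ^ (-s / 2) * |μ z.2.1|) *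
        ((‖z.1.1 - z.2.2‖ ^ 2 + z.1.2 ^ 2) ^ (-s / 2) * |μ z.2.2|)))
      ((volume.restrict {p | 0 < p.2}).prod (volume.prod volume)) := by
  rw [integrable_prod_iff (Measurable.aestronglyMeasurable (by fun_prop))]
  constructor
  · filter_upwards [ae_restrict_mem (measurableSet_upperHalfSpace d)] with p hp
    have h := integrable_kernel_mul hμ.abs hs.norm p hp (-s / 2)
    exact (h.mul_prod h).const_mul _
  · refine (integrable_weight_mul_Kext_sq hd hγ hs1 hs2 hμ hs).congr ?_
    filter_upwards [ae_restrict_mem (measurableSet_upperHalfSpace d)] with p hp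
    have hp : 0 < p.2 := hp
    have : ∀ y : EuclideanSpace ℝ (Fin d) × EuclideanSpace ℝ (Fin d),
        ‖p.2 ^ γ * (((‖p.1 - y.1‖ ^ 2 + p.2 ^ 2) ^ (-s / 2) * |μ y.1|) *
        ((‖p.1 - y.2‖ ^ 2 + p.2 ^ 2) ^ (-s / 2) * |μ y.2|))‖ =
        p.2 ^ γ * (((‖p.1 - y.1‖ ^ 2 + p.2 ^ 2) ^ (-s / 2) * |μ y.1|) *
        ((‖p.1 - y.2‖ ^ 2 + p.2 ^ 2) ^ (-s / 2) * |μ y.2|)) :=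
      fun y => Real.norm_of_nonneg (by positivity)
    simp only [this, integral_const_mul]
    rw [integral_prod_mul (fun y => (‖p.1 - y‖ ^ 2 + p.2 ^ 2) ^ (-s / 2) * |μ y|)
      (fun y => (‖p.1 - y‖ ^ 2 + p.2 ^ 2) ^ (-s / 2) * |μ y|)]
    simp only [Kext]
    ring

theorem IsRadialFamily.integrable_prod {d : ℕ} (hd : 0 < d) {ι : Type*} [Fintype ι] {s γ : ℝ}
    {k : ι → EuclideanSpace ℝ (Fin d) × ℝ → ℝ} (hk : IsRadialFamily s k) (hγ : -1 < γ)
    (hs1 : d + γ + 1 < 2 * s) (hs2 : s < d + (γ + 1) / 2)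
    {μ : EuclideanSpace ℝ (Fin d) → ℝ} (hμ : Continuous μ) (hs : HasCompactSupport μ) :
    Integrable (fun z : (EuclideanSpace ℝ (Fin d) × ℝ) ×
        (EuclideanSpace ℝ (Fin d) × EuclideanSpace ℝ (Fin d)) =>
      z.1.2 ^ γ * ∑ i, (k i (z.1.1 - z.2.1, z.1.2) * μ z.2.1) *
        (k i (z.1.1 - z.2.2, z.1.2) * μ z.2.2))
      ((volume.restrict {p | 0 < p.2}).prod (volume.prod volume)) := by
  obtain ⟨M, hM⟩ := hk.bound
  have hmeas := hk.measurable
  have hpos : ∀ᵐ z ∂((volume.restrict {p : EuclideanSpace ℝ (Fin d) × ℝ | 0 < p.2}).prod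
      ((volume : Measure (EuclideanSpace ℝ (Fin d))).prod
        (volume : Measure (EuclideanSpace ℝ (Fin d))))), 0 < z.1.2 :=
    Measure.quasiMeasurePreserving_fst.ae (ae_restrict_mem (measurableSet_upperHalfSpace d))
  refine ((integrable_kernel_sq_prod hd hγ hs1 hs2 hμ hs).const_mul (∑ _i : ι, M * M)).mono'
    (Measurable.aestronglyMeasurable ?_) ?_
  · have : ∀ i, Measurable fun z : (EuclideanSpace ℝ (Fin d) × ℝ) ×
        (EuclideanSpace ℝ (Fin d) × EuclideanSpace ℝ (Fin d)) =>
        (k i (z.1.1 - z.2.1, z.1.2) * μ z.2.1) * (k i (z.1.1 - z.2.2, z.1.2) * μ z.2.2) := by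
      intro i
      have := hmeas i
      fun_prop
    fun_prop
  · filter_upwards [hpos] with z hz
    have hb : ∀ i y, ‖k i (z.1.1 - y, z.1.2) * μ y‖ ≤
        M * ((‖z.1.1 - y‖ ^ 2 + z.1.2 ^ 2) ^ (-s / 2) * |μ y|) := by
      intro i y
      rw [norm_mul, ← mul_assoc]
      exact mul_le_mul_of_nonneg_right (hM i _ hz) (norm_nonneg _)
    rw [norm_mul, Real.norm_of_nonneg (by positivity), mul_left_comm]
    refine mul_le_mul_of_nonneg_left ?_ (by positivity)
    rw [Finset.sum_mul]
    refine (norm_sum_le _ _).trans (Finset.sum_le_sum fun i _ => ?_)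
    rw [norm_mul]
    refine (mul_le_mul (hb i _) (hb i _) (norm_nonneg _)
      ((norm_nonneg _).trans (hb i z.2.1))).trans_eq ?_
    ring

theorem IsRadialFamily.integral_energy {d : ℕ} (hd : 0 < d) {ι : Type*} [Fintype ι] {s γ α : ℝ}
    {k : ι → EuclideanSpace ℝ (Fin d) × ℝ → ℝ} (hk : IsRadialFamily s k) (hγ : -1 < γ)
    (hs1 : d + γ + 1 < 2 * s) (hs2 : s < d + (γ + 1) / 2) (hα : -α = d + 1 + γ - 2 * s)
    {e : EuclideanSpace ℝ (Fin d)} (he : ‖e‖ = 1)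
    {μ : EuclideanSpace ℝ (Fin d) → ℝ} (hμ : Continuous μ) (hs : HasCompactSupport μ) :
    IntegrableOn (fun p => p.2 ^ γ * ∑ i, (∫ y, k i (p.1 - y, p.2) * μ y) ^ 2)
        {p : EuclideanSpace ℝ (Fin d) × ℝ | 0 < p.2} ∧
      ∫ p in {p : EuclideanSpace ℝ (Fin d) × ℝ | 0 < p.2},
        p.2 ^ γ * ∑ i, (∫ y, k i (p.1 - y, p.2) * μ y) ^ 2
      = (∫ p, pairDensity γ k e p) * ∫ x, ∫ y, μ x * μ y * ‖x - y‖ ^ (-α) := by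
  have hint := hk.integrable_prod hd hγ hs1 hs2 hμ hs
  have hinner : (fun p : EuclideanSpace ℝ (Fin d) × ℝ =>
      ∫ z : EuclideanSpace ℝ (Fin d) × EuclideanSpace ℝ (Fin d),
      p.2 ^ γ * ∑ i, (k i (p.1 - z.1, p.2) * μ z.1) *
        (k i (p.1 - z.2, p.2) * μ z.2) ∂(volume.prod volume)) =ᵐ[volume.restrict {p | 0 < p.2}]
      fun p => p.2 ^ γ * ∑ i, (∫ y, k i (p.1 - y, p.2) * μ y) ^ 2 := by
    filter_upwards [ae_restrict_mem (measurableSet_upperHalfSpace d)] with p hp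
    have hi := fun i => hk.integrable_kernel hμ hs i hp
    rw [integral_const_mul, integral_finsetSum _ fun i _ => (hi i).mul_prod (hi i)]
    congr 2
    ext i
    rw [integral_prod_mul (fun y => k i (p.1 - y, p.2) * μ y)
      (fun y => k i (p.1 - y, p.2) * μ y), sq]
  refine ⟨hint.integral_prod_left.congr hinner, ?_⟩
  rw [← integral_congr_ae hinner, integral_integral_swap hint, integral_prod _
    hint.integral_prod_right, ← integral_const_mul]
  congr 1
  ext x
  rw [← integral_const_mul]
  refine integral_congr_ae ?_
  filter_upwards [ae_ne_of_pos hd x] with y hy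
  have h := hk.integral_pair_eq γ he hy.symm
  calc ∫ p in {p : EuclideanSpace ℝ (Fin d) × ℝ | 0 < p.2}, p.2 ^ γ *
        ∑ i, (k i (p.1 - x, p.2) * μ x) * (k i (p.1 - y, p.2) * μ y)
      = ∫ p in {p : EuclideanSpace ℝ (Fin d) × ℝ | 0 < p.2}, (μ x * μ y) * (p.2 ^ γ *
        ∑ i, k i (p.1 - x, p.2) * k i (p.1 - y, p.2)) := by
        congr 1
        ext p
        rw [mul_left_comm, Finset.mul_sum (a := μ x * μ y)]
        congr 2
        ext i
        ring
    _ = _ := by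
        rw [integral_const_mul, h, hα]
        ring

theorem IsRadialFamily.exists_pos_integral_energy {d : ℕ} (hd : 0 < d) {ι : Type*} [Fintype ι]
    {s γ α : ℝ} {k : ι → EuclideanSpace ℝ (Fin d) × ℝ → ℝ} (hk : IsRadialFamily s k)
    (hγ : -1 < γ) (hs1 : d + γ + 1 < 2 * s) (hs2 : s < d + (γ + 1) / 2)
    (hα : -α = d + 1 + γ - 2 * s) {i₀ : ι} (hpos : ∀ X, 0 < X.2 → 0 < k i₀ X) :
    ∃ A : ℝ, 0 < A ∧ ∀ μ : EuclideanSpace ℝ (Fin d) → ℝ, Continuous μ → HasCompactSupport μ →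
      ∫ p in {p : EuclideanSpace ℝ (Fin d) × ℝ | 0 < p.2},
        p.2 ^ γ * ∑ i, (∫ y, k i (p.1 - y, p.2) * μ y) ^ 2
      = A * ∫ x, ∫ y, μ x * μ y * ‖x - y‖ ^ (-α) := by
  set e : EuclideanSpace ℝ (Fin d) := EuclideanSpace.single ⟨0, hd⟩ 1
  have he : ‖e‖ = 1 := by simp [e]
  refine ⟨∫ p, pairDensity γ k e p, ?_, fun μ hμ hs =>
    (hk.integral_energy hd hγ hs1 hs2 hα he hμ hs).2⟩
  let μ : ContDiffBump (0 : EuclideanSpace ℝ (Fin d)) := default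
  obtain ⟨hint, heq⟩ := hk.integral_energy hd hγ hs1 hs2 hα he μ.continuous μ.hasCompactSupport
  have hE : 0 ≤ ∫ x, ∫ y, μ x * μ y * ‖x - y‖ ^ (-α) :=
    integral_nonneg fun x => integral_nonneg fun y =>
      mul_nonneg (mul_nonneg μ.nonneg μ.nonneg) (by positivity)
  have hu : ∀ p : EuclideanSpace ℝ (Fin d) × ℝ, 0 < p.2 →
      0 < p.2 ^ γ * ∑ i, (∫ y, k i (p.1 - y, p.2) * μ y) ^ 2 := by
    intro p hp
    have h1 : 0 < ∫ y, k i₀ (p.1 - y, p.2) * μ y := by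
      rw [integral_pos_iff_support_of_nonneg
        (fun y => mul_nonneg (hpos (p.1 - y, p.2) hp).le μ.nonneg)
        (hk.integrable_kernel μ.continuous μ.hasCompactSupport i₀ hp)]
      have hsup : Function.support (fun y => k i₀ (p.1 - y, p.2) * μ y)
          = Metric.ball 0 μ.rOut := by
        rw [← μ.support_eq]
        ext y
        simp [(hpos (p.1 - y, p.2) hp).ne']
      rw [hsup]
      exact Metric.measure_ball_pos _ _ μ.rOut_pos
    refine mul_pos (by positivity) (Finset.sum_pos' (fun i _ => sq_nonneg _)
      ⟨i₀, Finset.mem_univ _, by positivity⟩)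
  have hposint : 0 < ∫ p in {p : EuclideanSpace ℝ (Fin d) × ℝ | 0 < p.2},
        p.2 ^ γ * ∑ i, (∫ y, k i (p.1 - y, p.2) * μ y) ^ 2 := by
    rw [setIntegral_pos_iff_support_of_nonneg_ae ?_ hint]
    · have hopen : IsOpen {p : EuclideanSpace ℝ (Fin d) × ℝ | 0 < p.2} :=
        isOpen_lt continuous_const continuous_snd
      have hsub : {p : EuclideanSpace ℝ (Fin d) × ℝ | 0 < p.2} ⊆ Function.support
          fun p => p.2 ^ γ * ∑ i, (∫ y, k i (p.1 - y, p.2) * μ y) ^ 2 :=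
        fun p hp => (hu p hp).ne'
      rw [Set.inter_eq_self_of_subset_right hsub]
      exact hopen.measure_pos _ ⟨(0, 1), by simp⟩
    · filter_upwards [ae_restrict_mem (measurableSet_upperHalfSpace d)] with p hp
      exact (hu p hp).le
  rw [heq] at hposint
  exact pos_of_mul_pos_left hposint hE

theorem isRadialFamily_rpow (d : ℕ) (s : ℝ) :
    IsRadialFamily (d := d) s fun (_ : Unit) X => (‖X.1‖ ^ 2 + X.2 ^ 2) ^ (-s / 2) where
  measurable _ := by fun_prop
  bound := ⟨1, fun _ X hX => by rw [one_mul, abs_of_nonneg (by positivity)]⟩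
  homogeneous _ X t ht hX := by
    rw [Prod.smul_fst, Prod.smul_snd, norm_smul, Real.norm_of_nonneg ht.le, smul_eq_mul, mul_pow,
      mul_pow, ← mul_add, Real.mul_rpow (by positivity) (by positivity), ← Real.rpow_natCast t,
      ← Real.rpow_mul ht.le]
    congr 2
    push_cast
    ring
  rotation R X Y := by simp

theorem dir_castSucc (d : ℕ) (i : Fin d) :
    dir d i.castSucc = (EuclideanSpace.single i 1, 0) := by
  simp [dir]

theorem dir_last (d : ℕ) : dir d (Fin.last d) = (0, 1) := by
  simp [dir]

theorem sum_dir_mul (d : ℕ) (X Y : EuclideanSpace ℝ (Fin d) × ℝ) :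
    ∑ i, (inner ℝ X.1 (dir d i).1 + X.2 * (dir d i).2) *
      (inner ℝ Y.1 (dir d i).1 + Y.2 * (dir d i).2) = inner ℝ X.1 Y.1 + X.2 * Y.2 := by
  simp [Fin.sum_univ_castSucc, dir_castSucc, dir_last, PiLp.inner_apply, mul_comm]

theorem abs_inner_dir_le (d : ℕ) (X : EuclideanSpace ℝ (Fin d) × ℝ) (i : Fin (d + 1)) :
    |inner ℝ X.1 (dir d i).1 + X.2 * (dir d i).2| ≤ (‖X.1‖ ^ 2 + X.2 ^ 2) ^ (1 / 2 : ℝ) := by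
  rw [← Real.sqrt_eq_rpow]
  refine Real.abs_le_sqrt ?_
  have h := sum_dir_mul d X X
  rw [real_inner_self_eq_norm_sq, ← sq] at h
  rw [← h, sq]
  exact Finset.single_le_sum (f := fun i => (inner ℝ X.1 (dir d i).1 + X.2 * (dir d i).2) *
      (inner ℝ X.1 (dir d i).1 + X.2 * (dir d i).2)) (fun i _ => mul_self_nonneg _)
      (Finset.mem_univ i)

theorem isRadialFamily_gradient (d : ℕ) (s : ℝ) :
    IsRadialFamily (d := d) s fun (i : Fin (d + 1)) X =>
      (‖X.1‖ ^ 2 + X.2 ^ 2) ^ (-(s + 1) / 2) *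
        (inner ℝ X.1 (dir d i).1 + X.2 * (dir d i).2) where
  measurable i := by fun_prop
  bound := ⟨1, fun i X hX => by
    have hN : 0 < ‖X.1‖ ^ 2 + X.2 ^ 2 := by positivity
    rw [one_mul, abs_mul, abs_of_nonneg (by positivity : 0 ≤ (_ : ℝ) ^ (-(s + 1) / 2)),
      show -s / 2 = -(s + 1) / 2 + 1 / 2 by ring, Real.rpow_add hN]
    exact mul_le_mul_of_nonneg_left (abs_inner_dir_le d X i) (by positivity)⟩
  homogeneous i X t ht hX := by
    have h := (isRadialFamily_rpow d (s + 1)).homogeneous () X t ht hX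
    rw [h, Prod.smul_fst, Prod.smul_snd, real_inner_smul_left, smul_eq_mul,
      show -s = -(s + 1) + 1 by ring, Real.rpow_add ht, Real.rpow_one]
    ring
  rotation R X Y := by
    simp only [R.norm_map]
    have h := sum_dir_mul d (R X.1, X.2) (R Y.1, Y.2)
    rw [R.inner_map_map, ← sum_dir_mul] at h
    rw [Finset.sum_congr rfl fun i _ => mul_mul_mul_comm _ _ _ _, ← Finset.mul_sum, h,
      Finset.mul_sum]
    exact Finset.sum_congr rfl fun i _ => mul_mul_mul_comm _ _ _ _

theorem prod_iterate_coeff_ne_zero {d j k : ℕ} {α γ : ℝ} (hα : 0 < α)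
    (hγ : γ = α - d + 2 * j + 1) (hk : k ≤ j) :
    ∏ i ∈ Finset.range k, (α + 2 * i) * (α + 2 * i + 1 - d - γ) ≠ 0 := by
  refine Finset.prod_ne_zero_iff.2 fun i hi => mul_ne_zero (by positivity) ?_
  have : (i : ℝ) < j := by exact_mod_cast (Finset.mem_range.1 hi).trans_le hk
  rw [hγ]
  linarith

/-- Extension representation of the interaction energy for
`max(0, d-2j-2) < α < d-2j`, `γ = α - d + 2j + 1`: there is `c > 0` depending only on
`α, d, j` such that for every `μ ∈ C_c^∞(ℝ^d)`, the interaction energy equals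
`c ∬ ξ^γ |Δ_γ^{(j+1)/2} 𝒦_{μ,α}|²` if `j` is odd, and
`c ∬ ξ^γ |∇_{(x,ξ)} Δ_γ^{j/2} 𝒦_{μ,α}|²` if `j` is even. -/
theorem stmt_7 (d j : ℕ) (α γ : ℝ)
    (hα₁ : max 0 ((d : ℝ) - 2 * j - 2) < α) (hα₂ : α < (d : ℝ) - 2 * j)
    (hγ : γ = α - d + 2 * j + 1) :
    ∃ c : ℝ, 0 < c ∧
      ∀ μ : EuclideanSpace ℝ (Fin d) → ℝ,
        ContDiff ℝ (⊤ : ℕ∞) μ → HasCompactSupport μ →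
        (Odd j →
          (∫ x, ∫ y, μ x * μ y * ‖x - y‖ ^ (-α))
            = c * ∫ p in {p : EuclideanSpace ℝ (Fin d) × ℝ | 0 < p.2},
                p.2 ^ γ * ((dgamma d γ)^[(j + 1) / 2] (Kext d α μ) p) ^ 2) ∧
        (Even j →
          (∫ x, ∫ y, μ x * μ y * ‖x - y‖ ^ (-α))
            = c * ∫ p in {p : EuclideanSpace ℝ (Fin d) × ℝ | 0 < p.2},
                p.2 ^ γ * ∑ i : Fin (d + 1),
                  (fderiv ℝ ((dgamma d γ)^[j / 2] (Kext d α μ)) p (dir d i)) ^ 2) := by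
  have hα0 : 0 < α := (le_max_left _ _).trans_lt hα₁
  have hα3 : (d : ℝ) - 2 * j - 2 < α := (le_max_right _ _).trans_lt hα₁
  have hj0 : (0 : ℝ) ≤ j := by positivity
  have hd : 0 < d := by
    have : (0 : ℝ) < d := by linarith
    exact_mod_cast this
  have hγ1 : -1 < γ := by linarith
  have hs1 : d + γ + 1 < 2 * (α + j + 1) := by linarith
  have hs2 : α + j + 1 < d + (γ + 1) / 2 := by linarith
  have hs3 : -α = d + 1 + γ - 2 * (α + j + 1) := by linarith
  rcases Nat.even_or_odd j with hj | hj
  · obtain ⟨A, hA, hAμ⟩ := (isRadialFamily_gradient d (α + j + 1)).exists_pos_integral_energy hd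
      hγ1 hs1 hs2 hs3 (i₀ := Fin.last d) fun X hX => by
        simp only [dir_last, inner_zero_right, zero_add, mul_one]
        positivity
    have hk : (2 : ℝ) * ((j / 2 : ℕ) : ℝ) = j := by exact_mod_cast Nat.two_mul_div_two_of_even hj
    set C : ℝ := (∏ i ∈ Finset.range (j / 2), (α + 2 * i) * (α + 2 * i + 1 - d - γ)) * -(α + j)
    have hC : C ≠ 0 := mul_ne_zero (prod_iterate_coeff_ne_zero hα0 hγ (Nat.div_le_self _ _))
      (neg_ne_zero.2 (by positivity))
    refine ⟨(C ^ 2 * A)⁻¹, by positivity, fun μ hμ hs =>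
      ⟨fun h => absurd hj (Nat.not_even_iff_odd.2 h), fun _ => ?_⟩⟩
    rw [eq_inv_mul_iff_mul_eq₀ (by positivity), mul_assoc, ← hAμ μ hμ.continuous hs,
      ← integral_const_mul]
    refine setIntegral_congr_fun (measurableSet_upperHalfSpace d) fun p hp => ?_
    have hp : 0 < p.2 := hp
    have hfd : ∀ i, fderiv ℝ ((dgamma d γ)^[j / 2] (Kext d α μ)) p (dir d i) =
        C * ∫ y, (‖p.1 - y‖ ^ 2 + p.2 ^ 2) ^ (-(α + j + 1 + 1) / 2) *
          (inner ℝ (p.1 - y) (dir d i).1 + p.2 * (dir d i).2) * μ y := by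
      intro i
      rw [fderiv_eq_const_mul_of_eqOn
        (fun q hq => iterate_dgamma_Kext γ hα0 hμ.continuous hs (j / 2) q hq) p hp, hk,
        fderiv_Kext_apply (by positivity) hμ.continuous hs p hp, ← mul_assoc,
        show α + j + 1 + 1 = α + j + 2 by ring]
    simp only [hfd, mul_pow, ← Finset.mul_sum]
    ring
  · obtain ⟨A, hA, hAμ⟩ := (isRadialFamily_rpow d (α + j + 1)).exists_pos_integral_energy hd
      hγ1 hs1 hs2 hs3 (i₀ := ()) fun X hX => by positivity
    have hk : (2 : ℝ) * (((j + 1) / 2 : ℕ) : ℝ) = j + 1 := by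
      exact_mod_cast Nat.two_mul_div_two_of_even hj.add_one
    set C : ℝ := ∏ i ∈ Finset.range ((j + 1) / 2), (α + 2 * i) * (α + 2 * i + 1 - d - γ)
    have hC : C ≠ 0 := prod_iterate_coeff_ne_zero hα0 hγ (by have := hj.pos; omega)
    refine ⟨(C ^ 2 * A)⁻¹, by positivity, fun μ hμ hs =>
      ⟨fun _ => ?_, fun h => absurd h (Nat.not_even_iff_odd.2 hj)⟩⟩
    rw [eq_inv_mul_iff_mul_eq₀ (by positivity), mul_assoc, ← hAμ μ hμ.continuous hs,
      ← integral_const_mul]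
    refine setIntegral_congr_fun (measurableSet_upperHalfSpace d) fun p hp => ?_
    have hp : 0 < p.2 := hp
    simp only [iterate_dgamma_Kext γ hα0 hμ.continuous hs _ p hp, hk, Finset.univ_unique,
      Finset.sum_singleton, Kext, ← add_assoc]
    ring
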